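/- Let (W,S) be a finite Coxeter system and K ⊆ S. If z, w ∈ W are such that z ∈ X_K^{-1} and ω_K∘z ≤_B w in the weak Bruhat order of W, then W_K∘z ≤_B W_J∘w in the weak Bruhat order of P^{(W,S)}, for any J ⊆ S with w ∈ X_J^{-1}. -/

import Mathlib

namespace PaperWeakBruhat

variable {B W : Type*} [Group W] {M : CoxeterMatrix B}

/-- The weak Bruhat order on `W`: `x ≤_B x'` iff `x' = y * x` with `ℓ(x') = ℓ(y) + ℓ(x)`. -/
noncomputable def weakLE (cs : CoxeterSystem M W) (x x' : W) : Prop :=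
  ∃ y : W, x' = y * x ∧ cs.length x' = cs.length y + cs.length x

/-- The standard parabolic subgroup `W_J` generated by the simple reflections in `J`. -/
def parabolic (cs : CoxeterSystem M W) (J : Set B) : Subgroup W :=
  Subgroup.closure (cs.simple '' J)

/-- The Solomon subset `X_J` of elements having no descent at `J`. -/
noncomputable def solomon (cs : CoxeterSystem M W) (J : Set B) : Set W :=
  {w : W | ∀ s ∈ J, cs.length w < cs.length (w * cs.simple s)}

/-- The right coclass `W_J ∘ w`, as a subset of `W`. -/
def coclass (cs : CoxeterSystem M W) (J : Set B) (w : W) : Set W :=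
  {x : W | ∃ p ∈ parabolic cs J, x = p * w}

/-- The generating relations of the weak Bruhat order on the set `P^{(W,S)}` of right
coclasses of standard parabolic subgroups:
(1) `W_J ∘ w <_B W_{J∪{s}} ∘ w` and (2) `W_{J∪{s}} ∘ w <_B W_J ∘ (α_{J,s}⁻¹ ∘ w)`,
for `J ⊆ S`, `s ∈ S ∖ J` and `w ∈ X_{J∪{s}}⁻¹`, where `α_{J,s} = ξ_{J∪{s}}⁻¹ ∘ ξ_J`.
Here `ξ : Set B → W` is the family of longest elements of the Solomon sets `X_J`. -/
noncomputable def pRel (cs : CoxeterSystem M W) (ξ : Set B → W) :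
    Set W → Set W → Prop := fun A C =>
  ∃ (J : Set B) (s : B) (w : W), s ∉ J ∧ w⁻¹ ∈ solomon cs (J ∪ {s}) ∧
    ((A = coclass cs J w ∧ C = coclass cs (J ∪ {s}) w) ∨
     (A = coclass cs (J ∪ {s}) w ∧
        C = coclass cs J (((ξ (J ∪ {s}))⁻¹ * ξ J)⁻¹ * w)))

/-! ### The exchange property -/

open Classical in
/-- The action of a simple reflection on pairs consisting of a group element and a sign. -/
noncomputable def signAction (cs : CoxeterSystem M W) (i : B) : Function.End (W × ZMod 2) :=
  fun x => (cs.simple i * x.1 * cs.simple i, x.2 + if x.1 = cs.simple i then 1 else 0)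

theorem end_mul_apply {X : Type*} (f g : Function.End X) (x : X) : (f * g) x = f (g x) := rfl

theorem end_one_apply {X : Type*} (x : X) : (1 : Function.End X) x = x := rfl

open Classical in
theorem signAction_mul_pow_apply (cs : CoxeterSystem M W) (i j : B) (n : ℕ) (x : W × ZMod 2) :
    ((signAction cs i * signAction cs j) ^ n) x =
      ((cs.simple i * cs.simple j) ^ n * x.1 * ((cs.simple i * cs.simple j) ^ n)⁻¹,
        x.2 + ∑ k ∈ Finset.range (2 * n),
          if x.1 = cs.simple j * (cs.simple i * cs.simple j) ^ k then 1 else 0) := by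
  induction n with
  | zero => rw [pow_zero, end_one_apply]; simp
  | succ n ih =>
    obtain ⟨t, e⟩ := x
    rw [pow_succ', end_mul_apply, ih, end_mul_apply, Nat.mul_succ, Finset.sum_range_succ, Finset.sum_range_succ]
    set r := cs.simple i * cs.simple j with hr
    have hjr : cs.simple j * r = r⁻¹ * cs.simple j := by simp [hr, mul_assoc]
    have hjrn (k : ℕ) : cs.simple j * r ^ k = (r ^ k)⁻¹ * cs.simple j := by
      rw [← inv_pow]
      exact (show SemiconjBy (cs.simple j) r r⁻¹ from hjr).pow_right k
    have h1 : r ^ n * t * (r ^ n)⁻¹ = cs.simple j ↔ t = cs.simple j * r ^ (2 * n) := by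
      rw [two_mul, pow_add, ← mul_assoc, hjrn, mul_inv_eq_iff_eq_mul, ← eq_inv_mul_iff_mul_eq,
        mul_assoc]
    have h2 : cs.simple j * (r ^ n * t * (r ^ n)⁻¹) * cs.simple j = cs.simple i ↔
        t = cs.simple j * r ^ (2 * n + 1) := by
      have h3 : cs.simple j * r ^ (2 * n + 1) =
          (r ^ n)⁻¹ * (cs.simple j * cs.simple i * cs.simple j) * r ^ n := by
        rw [show 2 * n + 1 = n + (1 + n) by omega, pow_add, pow_add, ← mul_assoc, hjrn, pow_one, hr]
        simp only [mul_assoc]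
      rw [h3]
      constructor
      · intro h
        rw [← h]
        simp [mul_assoc]
      · intro h
        rw [h]
        simp [mul_assoc]
    simp only [signAction, h1, h2]
    refine Prod.ext ?_ ?_
    · simp only [pow_succ', hr, mul_inv_rev, CoxeterSystem.inv_simple, mul_assoc]
    · simp only [add_assoc]

theorem isLiftable_signAction (cs : CoxeterSystem M W) : M.IsLiftable (signAction cs) := by
  intro i j
  classical
  have h := cs.simple_mul_simple_pow i j
  generalize M i j = m at h ⊢
  funext x
  rw [signAction_mul_pow_apply, two_mul, Finset.sum_range_add, end_one_apply]
  simp only [pow_add, h, one_mul]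
  rw [CharTwo.add_self_eq_zero]
  simp

/-- The extension of `signAction` to the whole group. -/
noncomputable def signHom (cs : CoxeterSystem M W) : W →* Function.End (W × ZMod 2) :=
  cs.lift ⟨signAction cs, isLiftable_signAction cs⟩

theorem signHom_simple (cs : CoxeterSystem M W) (i : B) :
    signHom cs (cs.simple i) = signAction cs i :=
  cs.lift_apply_simple (isLiftable_signAction cs) i

open Classical in
theorem signHom_wordProd (cs : CoxeterSystem M W) (ω : List B) (x : W × ZMod 2) :
    signHom cs (cs.wordProd ω) x =
      (cs.wordProd ω * x.1 * (cs.wordProd ω)⁻¹, x.2 + (cs.rightInvSeq ω).count x.1) := by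
  induction ω with
  | nil =>
    rw [cs.wordProd_nil, map_one, end_one_apply]
    simp
  | cons i ω ih =>
    rw [cs.wordProd_cons, map_mul, end_mul_apply, ih, signHom_simple]
    have h : cs.wordProd ω * x.1 * (cs.wordProd ω)⁻¹ = cs.simple i ↔
        (cs.wordProd ω)⁻¹ * cs.simple i * cs.wordProd ω = x.1 := by
      rw [mul_inv_eq_iff_eq_mul, ← eq_inv_mul_iff_mul_eq, mul_assoc, eq_comm]
    simp only [signAction, CoxeterSystem.rightInvSeq, List.count_cons, h, beq_iff_eq]
    refine Prod.ext ?_ ?_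
    · simp [mul_assoc]
    · push_cast
      rw [add_assoc]

theorem simple_mem_rightInvSeq (cs : CoxeterSystem M W) (ω : List B) (i : B)
    (h : cs.IsRightDescent (cs.wordProd ω) i) : cs.simple i ∈ cs.rightInvSeq ω := by
  classical
  obtain ⟨u, hu, hwu⟩ := cs.exists_isReduced (cs.wordProd ω * cs.simple i)
  have hnot : cs.simple i ∉ cs.rightInvSeq u := by
    intro hmem
    have h1 := (cs.isRightInversion_of_mem_rightInvSeq hu hmem).2
    rw [← hwu, cs.simple_mul_simple_cancel_right] at h1
    exact lt_asymm h h1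
  have h1 : cs.wordProd ω = cs.wordProd u * cs.simple i := by
    rw [← hwu, cs.simple_mul_simple_cancel_right]
  have h2 : (signHom cs (cs.wordProd ω) (cs.simple i, 0)).2 = 1 := by
    rw [h1, map_mul, end_mul_apply, signHom_simple, signHom_wordProd]
    simp [signAction, List.count_eq_zero_of_not_mem hnot]
  rw [signHom_wordProd] at h2
  by_contra hmem
  simp [List.count_eq_zero_of_not_mem hmem] at h2

/-- The exchange property. -/
theorem exists_eraseIdx_of_isLeftDescent (cs : CoxeterSystem M W) (ω : List B) (i : B)
    (h : cs.IsLeftDescent (cs.wordProd ω) i) :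
    ∃ j < ω.length, cs.simple i * cs.wordProd ω = cs.wordProd (ω.eraseIdx j) := by
  have h1 : cs.simple i ∈ cs.leftInvSeq ω := by
    rw [← List.mem_reverse, ← cs.rightInvSeq_reverse]
    apply simple_mem_rightInvSeq
    rwa [cs.wordProd_reverse, cs.isRightDescent_inv_iff]
  obtain ⟨j, hj, hij⟩ := List.mem_iff_getElem.mp h1
  refine ⟨j, by simpa using hj, ?_⟩
  rw [← cs.getD_leftInvSeq_mul_wordProd, List.getD_eq_getElem _ _ hj, hij]

theorem length_wordProd_eraseIdx_lt (cs : CoxeterSystem M W) {ω : List B} {j : ℕ}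
    (hj : j < ω.length) : cs.length (cs.wordProd (ω.eraseIdx j)) < ω.length := by
  have h1 := cs.length_wordProd_le (ω.eraseIdx j)
  have h2 := List.length_eraseIdx_add_one hj
  omega

/-! ### Parabolic subgroups -/

theorem simple_mem_parabolic (cs : CoxeterSystem M W) {J : Set B} {i : B} (hi : i ∈ J) :
    cs.simple i ∈ parabolic cs J :=
  Subgroup.subset_closure ⟨i, hi, rfl⟩

theorem wordProd_mem_parabolic (cs : CoxeterSystem M W) {J : Set B} {ω : List B}
    (h : ∀ i ∈ ω, i ∈ J) : cs.wordProd ω ∈ parabolic cs J := by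
  induction ω with
  | nil => simp [one_mem]
  | cons i ω ih =>
    rw [cs.wordProd_cons]
    exact mul_mem (simple_mem_parabolic cs (h i (by simp)))
      (ih fun j hj => h j (List.mem_cons_of_mem _ hj))

theorem parabolic_mono (cs : CoxeterSystem M W) {J K : Set B} (h : J ⊆ K) :
    parabolic cs J ≤ parabolic cs K :=
  Subgroup.closure_mono (Set.image_mono h)

theorem isReduced_of_cons (cs : CoxeterSystem M W) {i : B} {ω : List B}
    (h : cs.IsReduced (i :: ω)) : cs.IsReduced ω := by
  simpa using h.drop 1

theorem exists_isReduced_of_mem_parabolic (cs : CoxeterSystem M W) {J : Set B} {p : W}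
    (hp : p ∈ parabolic cs J) :
    ∃ ω : List B, cs.IsReduced ω ∧ (∀ i ∈ ω, i ∈ J) ∧ cs.wordProd ω = p := by
  have step : ∀ i ∈ J, ∀ q : W,
      (∃ ω : List B, cs.IsReduced ω ∧ (∀ i ∈ ω, i ∈ J) ∧ cs.wordProd ω = q) →
      ∃ ω : List B, cs.IsReduced ω ∧ (∀ i ∈ ω, i ∈ J) ∧ cs.wordProd ω = cs.simple i * q := by
    rintro i hi _ ⟨ω, hω, hωJ, rfl⟩
    by_cases hd : cs.IsLeftDescent (cs.wordProd ω) i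
    · obtain ⟨j, hj, he⟩ := exists_eraseIdx_of_isLeftDescent cs ω i hd
      refine ⟨ω.eraseIdx j, ?_, fun k hk => hωJ k (List.mem_of_mem_eraseIdx hk), he.symm⟩
      have h1 := cs.isLeftDescent_iff.mp hd
      have h2 := List.length_eraseIdx_add_one hj
      have h3 := hω.eq
      unfold CoxeterSystem.IsReduced
      rw [← he]
      omega
    · refine ⟨i :: ω, ?_, by simpa using ⟨hi, hωJ⟩, cs.wordProd_cons i ω⟩
      unfold CoxeterSystem.IsReduced
      rw [cs.wordProd_cons, cs.not_isLeftDescent_iff.mp hd, hω.eq, List.length_cons]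
  induction hp using Subgroup.closure_induction_left with
  | one => exact ⟨[], by simp [CoxeterSystem.IsReduced], by simp, by simp⟩
  | mul_left x hx y hy ih =>
    obtain ⟨i, hi, rfl⟩ := hx
    exact step i hi y ih
  | inv_mul_cancel x hx y hy ih =>
    obtain ⟨i, hi, rfl⟩ := hx
    rw [cs.inv_simple]
    exact step i hi y ih

theorem inv_mem_solomon_iff (cs : CoxeterSystem M W) {J : Set B} {z : W} :
    z⁻¹ ∈ solomon cs J ↔ ∀ i ∈ J, cs.length z < cs.length (cs.simple i * z) := by
  refine forall₂_congr fun i _ => ?_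
  rw [← cs.length_inv (cs.simple i * z), mul_inv_rev, cs.inv_simple, cs.length_inv]

theorem length_wordProd_mul_of_forall_le (cs : CoxeterSystem M W) {J : Set B} {z : W}
    (hz : ∀ q ∈ parabolic cs J, cs.length z ≤ cs.length (q * z)) {ω : List B}
    (hω : cs.IsReduced ω) (hωJ : ∀ i ∈ ω, i ∈ J) :
    cs.length (cs.wordProd ω * z) = ω.length + cs.length z := by
  induction ω with
  | nil => simp
  | cons i ω ih =>
    have hωJ' : ∀ j ∈ ω, j ∈ J := fun j hj => hωJ j (List.mem_cons_of_mem _ hj)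
    have ih := ih (isReduced_of_cons cs hω) hωJ'
    rw [cs.wordProd_cons, mul_assoc]
    by_cases hd : cs.IsLeftDescent (cs.wordProd ω * z) i
    · exfalso
      obtain ⟨u, hu, rfl⟩ := cs.exists_isReduced z
      rw [← cs.wordProd_append] at hd
      obtain ⟨j, hj, he⟩ := exists_eraseIdx_of_isLeftDescent cs _ i hd
      rcases lt_or_ge j ω.length with hjω | hjω
      · rw [List.eraseIdx_append_of_lt_length hjω, cs.wordProd_append, cs.wordProd_append,
          ← mul_assoc, mul_left_inj, ← cs.wordProd_cons] at he
        have h1 := length_wordProd_eraseIdx_lt cs hjω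
        rw [← he, hω.eq, List.length_cons] at h1
        omega
      · rw [List.eraseIdx_append_of_length_le hjω, cs.wordProd_append, cs.wordProd_append] at he
        rw [List.length_append] at hj
        have h1 := length_wordProd_eraseIdx_lt cs (ω := u) (j := j - ω.length) (by omega)
        have hmem := wordProd_mem_parabolic cs hωJ'
        have h2 := hz ((cs.wordProd ω)⁻¹ * cs.simple i * cs.wordProd ω)
          (mul_mem (mul_mem (inv_mem hmem) (simple_mem_parabolic cs (hωJ i (by simp)))) hmem)
        rw [mul_assoc, mul_assoc, he, inv_mul_cancel_left, hu.eq] at h2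
        omega
    · rw [cs.not_isLeftDescent_iff.mp hd, ih, List.length_cons]
      omega

/-- Lengths add along the factorization `W = W_J ∘ X_J⁻¹`. -/
theorem length_mul_of_mem_parabolic (cs : CoxeterSystem M W) {J : Set B} {p z : W}
    (hp : p ∈ parabolic cs J) (hz : z⁻¹ ∈ solomon cs J) :
    cs.length (p * z) = cs.length p + cs.length z := by
  rw [inv_mem_solomon_iff] at hz
  let f : parabolic cs J → ℕ := fun q => cs.length ((q : W) * z)
  obtain ⟨q, hq⟩ : ∃ q, ∀ x, f q ≤ f x := ⟨Function.argmin f, fun x => Function.argmin_le f x⟩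
  have hmin : ∀ x ∈ parabolic cs J, cs.length (q * z) ≤ cs.length (x * (q * z)) := by
    intro x hx
    simpa [f, mul_assoc] using hq (⟨x, hx⟩ * q)
  obtain ⟨u, hu, huJ, hqu⟩ := exists_isReduced_of_mem_parabolic cs (inv_mem q.2)
  have hzu : z = cs.wordProd u * (q * z) := by rw [hqu, inv_mul_cancel_left]
  have hnil : u = [] := by
    cases u with
    | nil => rfl
    | cons i u =>
      exfalso
      have h1 := length_wordProd_mul_of_forall_le cs hmin hu huJ
      have h2 := length_wordProd_mul_of_forall_le cs hmin (isReduced_of_cons cs hu)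
        (fun j hj => huJ j (List.mem_cons_of_mem _ hj))
      have h3 := hz i (huJ i (by simp))
      rw [hzu, h1, cs.wordProd_cons, mul_assoc, cs.simple_mul_simple_cancel_left, h2,
        List.length_cons] at h3
      omega
  rw [hnil, cs.wordProd_nil, one_mul] at hzu
  rw [← hzu] at hmin
  obtain ⟨ω, hω, hωJ, rfl⟩ := exists_isReduced_of_mem_parabolic cs hp
  rw [length_wordProd_mul_of_forall_le cs hmin hω hωJ, hω.eq]

/-! ### Longest elements of parabolic subgroups -/

/-- `u` is an element of maximal length of `W_J`. -/
def IsLongest (cs : CoxeterSystem M W) (J : Set B) (u : W) : Prop :=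
  u ∈ parabolic cs J ∧ ∀ x ∈ parabolic cs J, cs.length x ≤ cs.length u

namespace IsLongest

variable {cs : CoxeterSystem M W} {J : Set B} {u v p : W}

theorem exists_eq_wordProd_mul (hu : IsLongest cs J u) {ω : List B} (hω : cs.IsReduced ω)
    (hωJ : ∀ i ∈ ω, i ∈ J) :
    ∃ v : W, u = cs.wordProd ω * v ∧ cs.length u = ω.length + cs.length v := by
  induction ω with
  | nil => exact ⟨u, by simp⟩
  | cons i ω ih =>
    obtain ⟨v, huv, hlen⟩ := ih (isReduced_of_cons cs hω)
      (fun j hj => hωJ j (List.mem_cons_of_mem _ hj))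
    obtain ⟨a, ha, rfl⟩ := cs.exists_isReduced v
    have hd : cs.IsLeftDescent u i :=
      lt_of_le_of_ne (hu.2 _ (mul_mem (simple_mem_parabolic cs (hωJ i (by simp))) hu.1))
        (cs.length_simple_mul_ne u i)
    rw [huv, ← cs.wordProd_append] at hd
    obtain ⟨j, hj, he⟩ := exists_eraseIdx_of_isLeftDescent cs _ i hd
    rw [cs.wordProd_append, ← huv] at he
    rcases lt_or_ge j ω.length with hjω | hjω
    · exfalso
      rw [List.eraseIdx_append_of_lt_length hjω, cs.wordProd_append, huv,
        ← mul_assoc, mul_left_inj, ← cs.wordProd_cons] at he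
      have h1 := length_wordProd_eraseIdx_lt cs hjω
      rw [← he, hω.eq, List.length_cons] at h1
      omega
    · rw [List.eraseIdx_append_of_length_le hjω, cs.wordProd_append] at he
      rw [List.length_append] at hj
      have h1 := length_wordProd_eraseIdx_lt cs (ω := a) (j := j - ω.length) (by omega)
      have hu' : u = cs.wordProd (i :: ω) * cs.wordProd (a.eraseIdx (j - ω.length)) := by
        rw [cs.wordProd_cons, mul_assoc, ← he, cs.simple_mul_simple_cancel_left]
      refine ⟨_, hu', ?_⟩
      have h2 := cs.length_mul_le (cs.wordProd (i :: ω))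
        (cs.wordProd (a.eraseIdx (j - ω.length)))
      rw [← hu', hω.eq] at h2
      rw [ha.eq] at hlen
      rw [List.length_cons] at h2 ⊢
      omega

theorem length_eq_add (hu : IsLongest cs J u) (hp : p ∈ parabolic cs J) :
    cs.length u = cs.length p + cs.length (p⁻¹ * u) := by
  obtain ⟨ω, hω, hωJ, rfl⟩ := exists_isReduced_of_mem_parabolic cs hp
  obtain ⟨v, hv, hlen⟩ := hu.exists_eq_wordProd_mul hω hωJ
  have h : (cs.wordProd ω)⁻¹ * u = v := by rw [hv, inv_mul_cancel_left]
  rw [h, hω.eq, hlen]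

theorem eq (hu : IsLongest cs J u) (hv : IsLongest cs J v) : u = v := by
  have h1 := hu.length_eq_add hv.1
  have h2 := hv.2 u hu.1
  have h3 := hu.2 v hv.1
  have h4 : v⁻¹ * u = 1 := cs.length_eq_zero_iff.mp (by omega)
  exact (inv_mul_eq_one.mp h4).symm

theorem inv_eq (hu : IsLongest cs J u) : u⁻¹ = u :=
  IsLongest.eq ⟨inv_mem hu.1, fun x hx => by rw [cs.length_inv]; exact hu.2 x hx⟩ hu

theorem mul_self (hu : IsLongest cs J u) : u * u = 1 :=
  inv_eq_iff_mul_eq_one.mp hu.inv_eq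

theorem eq_one (hu : IsLongest cs ∅ u) : u = 1 := by
  simpa [parabolic] using hu.1

theorem eq_simple {i : B} (hu : IsLongest cs {i} u) : u = cs.simple i := by
  refine hu.eq ⟨simple_mem_parabolic cs rfl, fun x hx => ?_⟩
  have hx' : x = 1 ∨ x = cs.simple i := by
    rw [parabolic, Set.image_singleton] at hx
    induction hx using Subgroup.closure_induction_left with
    | one => exact Or.inl rfl
    | mul_left a ha b hb ih =>
      obtain rfl : a = cs.simple i := ha
      rcases ih with rfl | rfl <;> simp
    | inv_mul_cancel a ha b hb ih =>
      obtain rfl : a = cs.simple i := ha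
      rcases ih with rfl | rfl <;> simp
  rcases hx' with rfl | rfl <;> simp

/-- Moving down from `W_L ∘ z` to `W_K`-cosets preserves the minimality of representatives. -/
theorem inv_mul_mul_mem_solomon {K L : Set B} {z : W} (hKL : K ⊆ L) (hu : IsLongest cs K u)
    (hv : IsLongest cs L v) (hz : z⁻¹ ∈ solomon cs L) :
    (u * v * z)⁻¹ ∈ solomon cs K := by
  rw [inv_mem_solomon_iff]
  intro i hi
  have hle := parabolic_mono cs hKL
  have key : ∀ p ∈ parabolic cs K,
      cs.length (p * v * z) + cs.length p = cs.length v + cs.length z := by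
    intro p hp
    rw [length_mul_of_mem_parabolic cs (mul_mem (hle hp) hv.1) hz]
    have h := hv.length_eq_add (inv_mem (hle hp))
    rw [inv_inv, cs.length_inv] at h
    omega
  have hiu : cs.simple i * u ∈ parabolic cs K := mul_mem (simple_mem_parabolic cs hi) hu.1
  have h1 := key u hu.1
  have h2 := key _ hiu
  have h3 := hu.2 _ hiu
  have h4 := cs.length_simple_mul_ne u i
  rw [← mul_assoc, ← mul_assoc]
  omega

end IsLongest

/-! ### Chains in the weak Bruhat order on coclasses -/

theorem solomon_antitone (cs : CoxeterSystem M W) {J K : Set B} (h : J ⊆ K) :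
    solomon cs K ⊆ solomon cs J :=
  fun _ hw i hi => hw i (h hi)

theorem reflTransGen_coclass_empty_coclass (cs : CoxeterSystem M W) (ξ : Set B → W) {J : Set B}
    (hJ : J.Finite) {w : W} (hw : w⁻¹ ∈ solomon cs J) :
    Relation.ReflTransGen (pRel cs ξ) (coclass cs ∅ w) (coclass cs J w) := by
  induction J, hJ using Set.Finite.induction_on with
  | empty => exact .refl
  | @insert i J hi _ ih =>
    refine (ih (solomon_antitone cs (Set.subset_insert i J) hw)).tail
      ⟨J, i, w, hi, ?_, Or.inl ⟨rfl, ?_⟩⟩ <;> rw [Set.union_singleton]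
    exact hw

section

variable {cs : CoxeterSystem M W} {u : W} {ωf ξ : Set B → W}

theorem reflTransGen_coclass_coclass_empty (hω : ∀ J, IsLongest cs J (ωf J))
    (hξ : ∀ J, u = ξ J * ωf J) {K : Set B} (hK : K.Finite) {z : W} (hz : z⁻¹ ∈ solomon cs K) :
    Relation.ReflTransGen (pRel cs ξ) (coclass cs K z) (coclass cs ∅ (ωf K * z)) := by
  induction K, hK using Set.Finite.induction_on generalizing z with
  | empty => rw [(hω ∅).eq_one, one_mul]
  | @insert i K hi _ ih =>
    have hα : ((ξ (K ∪ {i}))⁻¹ * ξ K)⁻¹ = ωf K * ωf (insert i K) := by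
      rw [eq_mul_inv_of_mul_eq (hξ K).symm, eq_mul_inv_of_mul_eq (hξ (K ∪ {i})).symm,
        Set.union_singleton, (hω K).inv_eq, (hω (insert i K)).inv_eq]
      simp [mul_assoc, (hω K).inv_eq, (hω (insert i K)).inv_eq]
    have h := ih ((hω K).inv_mul_mul_mem_solomon (Set.subset_insert i K) (hω _) hz)
    rw [← mul_assoc, ← mul_assoc, (hω K).mul_self, one_mul] at h
    refine .head ⟨K, i, z, hi, ?_, Or.inr ⟨?_, rfl⟩⟩ (hα ▸ h) <;> rw [Set.union_singleton]
    exact hz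

theorem reflTransGen_coclass_empty_simple_mul (hω : ∀ J, IsLongest cs J (ωf J))
    (hξ : ∀ J, u = ξ J * ωf J) {i : B} {x : W} (h : cs.length x < cs.length (cs.simple i * x)) :
    Relation.ReflTransGen (pRel cs ξ) (coclass cs ∅ x) (coclass cs ∅ (cs.simple i * x)) := by
  have hx : x⁻¹ ∈ solomon cs {i} := (inv_mem_solomon_iff cs).mpr (by simpa using h)
  have hdown := reflTransGen_coclass_coclass_empty hω hξ (Set.finite_singleton i) hx
  rw [(hω {i}).eq_simple] at hdown
  exact (reflTransGen_coclass_empty_coclass cs ξ (Set.finite_singleton i) hx).trans hdown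

theorem reflTransGen_coclass_empty_of_weakLE (hω : ∀ J, IsLongest cs J (ωf J))
    (hξ : ∀ J, u = ξ J * ωf J) {x w : W} (h : weakLE cs x w) :
    Relation.ReflTransGen (pRel cs ξ) (coclass cs ∅ x) (coclass cs ∅ w) := by
  obtain ⟨y, rfl, hlen⟩ := h
  obtain ⟨a, ha, rfl⟩ := cs.exists_isReduced y
  rw [ha.eq] at hlen
  clear ha
  induction a with
  | nil => simpa using Relation.ReflTransGen.refl
  | cons i a ih =>
    rw [cs.wordProd_cons, mul_assoc, List.length_cons] at hlen
    rw [cs.wordProd_cons, mul_assoc]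
    have h1 := cs.length_mul_le (cs.wordProd a) x
    have h2 := cs.length_wordProd_le a
    have h3 := cs.length_mul_le (cs.simple i) (cs.wordProd a * x)
    rw [cs.length_simple] at h3
    exact (ih (by omega)).trans (reflTransGen_coclass_empty_simple_mul hω hξ (by omega))

end

/-- In a finite group, every set of simple reflections is labelled by a finite subset of its labels. -/
theorem exists_finite_image_simple_eq [Finite W] (cs : CoxeterSystem M W) (J : Set B) :
    ∃ J' ⊆ J, J'.Finite ∧ cs.simple '' J' = cs.simple '' J :=
  let ⟨J', hJ', h⟩ := Set.exists_subset_bijOn J cs.simple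
  ⟨J', hJ', h.finite_iff_finite.mpr (Set.toFinite _), h.image_eq⟩

theorem coclass_congr (cs : CoxeterSystem M W) {J K : Set B}
    (h : cs.simple '' J = cs.simple '' K) (w : W) : coclass cs J w = coclass cs K w := by
  simp only [coclass, parabolic, h]

/-- if `z ∈ X_K⁻¹` and `ω_K ∘ z ≤_B w` in the weak Bruhat order of `W`, then
`W_K ∘ z ≤_B W_J ∘ w` in the weak Bruhat order of `P^{(W,S)}`, for any `J` with `w ∈ X_J⁻¹`. -/
theorem coclass_le_of_weakLE [Finite W] (cs : CoxeterSystem M W)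
    (ωS : W) (ωf ξ : Set B → W)
    (hS : ∀ w : W, cs.length w ≤ cs.length ωS)
    (hω : ∀ J : Set B, ωf J ∈ parabolic cs J ∧
      ∀ x ∈ parabolic cs J, cs.length x ≤ cs.length (ωf J))
    (hξ : ∀ J : Set B, ξ J ∈ solomon cs J ∧ ωS = ξ J * ωf J)
    (K J : Set B) (z w : W)
    (hz : z⁻¹ ∈ solomon cs K)
    (hw : w⁻¹ ∈ solomon cs J)
    (h : weakLE cs (ωf K * z) w) :
    Relation.ReflTransGen (pRel cs ξ) (coclass cs K z) (coclass cs J w) := by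
  have hL : ∀ J, IsLongest cs J (ωf J) := hω
  have hξ' : ∀ J, ωS = ξ J * ωf J := fun J => (hξ J).2
  obtain ⟨J', hJ', hJfin, hJ⟩ := exists_finite_image_simple_eq cs J
  obtain ⟨K', hK', hKfin, hK⟩ := exists_finite_image_simple_eq cs K
  have hωK : ωf K' = ωf K := by
    refine (hL K').eq ?_
    have h1 := hL K
    unfold IsLongest parabolic at h1 ⊢
    rwa [hK]
  rw [← coclass_congr cs hJ, ← coclass_congr cs hK]
  rw [← hωK] at h
  exact (reflTransGen_coclass_coclass_empty hL hξ' hKfin (solomon_antitone cs hK' hz)).trans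
    ((reflTransGen_coclass_empty_of_weakLE hL hξ' h).trans
      (reflTransGen_coclass_empty_coclass cs ξ hJfin (solomon_antitone cs hJ' hw)))

end PaperWeakBruhat
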